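/- Fix 0 ≤ γ < 1 and p ∈ (0,2], and let Ω_γ := {z ∈ ℂ : |z + γ/(1−γ)| < 1/(1−γ)}. Let H be a complex Hilbert space with H ≠ {0}, and let φ = (φ_n)_{n=0}^∞ be a sequence of non-negative continuous functions on [0,1) such that the series ∑_{n=0}^∞ φ_n(r) converges locally uniformly on [0,1). Then for every r ∈ (0,1) with 2·∑_{n=1}^∞ φ_n(r) > p(1+γ)·φ₀(r), there exists a holomorphic f : Ω_γ → B(H) with ‖f(z)‖ ≤ 1 for all z ∈ Ω_γ, whose Taylor coefficients (A_n)_{n≥0} at 0 satisfy A₀ = a₀·I for some a₀ ∈ (0,1), such that ‖A₀‖^p φ₀(r) + ∑_{n=1}^∞ ‖A_n‖ φ_n(r) > φ₀(r). Indeed, one may take f(z) = ((a − γ − (1−γ)z)/(1 − aγ − a(1−γ)z))·I for a ∈ (γ,1) sufficiently close to 1. -/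

import Mathlib

open scoped BigOperators

/-- The simply connected domain `Ω_γ = {z : |z + γ/(1-γ)| < 1/(1-γ)}`. -/
def OmegaGamma (γ : ℝ) : Set ℂ :=
  Metric.ball (-((γ : ℂ) / (1 - (γ : ℂ)))) (1 / (1 - γ))

open Filter Topology

lemma one_sub_rpow_le {x p : ℝ} (hx : 0 < x) (hp : 0 ≤ p) :
    1 - x ^ p ≤ p * ((1 - x) / x) := by
  have h₁ : p * Real.log x + 1 ≤ x ^ p := by
    rw [Real.rpow_def_of_pos hx, mul_comm (Real.log x)]
    exact Real.add_one_le_exp _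
  have h₂ : p * (1 - x⁻¹) ≤ p * Real.log x :=
    mul_le_mul_of_nonneg_left (Real.one_sub_inv_le_log_of_pos hx) hp
  have h₃ : (1 - x) / x = -(1 - x⁻¹) := by field_simp; ring
  rw [h₃]
  linarith

/-- A point of `Ω_γ` is mapped into the unit disc by `z ↦ γ + (1-γ)z`. -/
lemma norm_affine_lt_one_of_mem_OmegaGamma {γ : ℝ} (hγ : γ < 1) {z : ℂ}
    (hz : z ∈ OmegaGamma γ) : ‖(γ : ℂ) + (1 - (γ : ℂ)) * z‖ < 1 := by
  have h : 0 < 1 - γ := sub_pos.2 hγ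
  have hc : (1 - (γ : ℂ)) ≠ 0 := by exact_mod_cast h.ne'
  rw [OmegaGamma, Metric.mem_ball, dist_eq_norm, lt_div_iff₀ h] at hz
  have he : (γ : ℂ) + (1 - (γ : ℂ)) * z
      = (z - -((γ : ℂ) / (1 - (γ : ℂ)))) * ((1 - γ : ℝ) : ℂ) := by
    push_cast
    field_simp
    ring
  rwa [he, norm_mul, Complex.norm_real, Real.norm_of_nonneg h.le]

lemma one_sub_real_mul_ne_zero {a : ℝ} (ha₀ : 0 ≤ a) (ha₁ : a ≤ 1) {w : ℂ} (hw : ‖w‖ < 1) :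
    1 - (a : ℂ) * w ≠ 0 := by
  intro h
  have h₁ : ‖(a : ℂ) * w‖ = 1 := by rw [← sub_eq_zero.1 h, norm_one]
  rw [norm_mul, Complex.norm_real, Real.norm_of_nonneg ha₀] at h₁
  nlinarith [norm_nonneg w]

lemma norm_real_moebius_le_one {a : ℝ} (ha₀ : 0 ≤ a) (ha₁ : a ≤ 1) {w : ℂ} (hw : ‖w‖ < 1) :
    ‖((a : ℂ) - w) / (1 - (a : ℂ) * w)‖ ≤ 1 := by
  rw [norm_div]
  refine div_le_one_of_le₀ ?_ (norm_nonneg _)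
  refine le_of_sq_le_sq ?_ (norm_nonneg _)
  have h : ‖w‖ ^ 2 ≤ 1 := pow_le_one₀ (norm_nonneg _) hw.le
  have ha : 0 ≤ 1 - a ^ 2 := by nlinarith
  have hprod := mul_nonneg ha (sub_nonneg.2 h)
  simp only [← Complex.normSq_eq_norm_sq, Complex.normSq_apply] at hprod ⊢
  simp
  nlinarith

/-- Taylor coefficients at `0` of `(a - γ - (1-γ)z) / (1 - aγ - a(1-γ)z)`. -/
noncomputable def moebiusCoeff (γ a : ℝ) : ℕ → ℝ
  | 0 => (a - γ) / (1 - a * γ)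
  | n + 1 => -((1 - γ) * (1 - a ^ 2) / (1 - a * γ) ^ 2) * (a * (1 - γ) / (1 - a * γ)) ^ n

lemma moebius_ratio_mem_Ico {γ a : ℝ} (hγ₀ : 0 ≤ γ) (haγ : γ < a) (ha₁ : a < 1) :
    a * (1 - γ) / (1 - a * γ) ∈ Set.Ico (0 : ℝ) 1 := by
  have hD : 0 < 1 - a * γ := by nlinarith
  refine ⟨div_nonneg (mul_nonneg (by linarith) (by linarith)) hD.le, ?_⟩
  rw [div_lt_one hD]
  linarith

lemma hasSum_moebiusCoeff {γ a : ℝ} (hγ₀ : 0 ≤ γ) (haγ : γ < a) (ha₁ : a < 1)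
    {z : ℂ} (hz : ‖z‖ < 1) :
    HasSum (fun n => z ^ n * (moebiusCoeff γ a n : ℂ))
      (((a : ℂ) - (γ : ℂ) - (1 - (γ : ℂ)) * z) /
        (1 - (a : ℂ) * (γ : ℂ) - (a : ℂ) * (1 - (γ : ℂ)) * z)) := by
  have hD : 0 < 1 - a * γ := by nlinarith
  have hDc : (1 - (a : ℂ) * (γ : ℂ)) ≠ 0 := by exact_mod_cast hD.ne'
  obtain ⟨hc₀, hc₁⟩ := moebius_ratio_mem_Ico hγ₀ haγ ha₁
  set c : ℝ := a * (1 - γ) / (1 - a * γ) with hc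
  have hne : 1 - (c : ℂ) * z ≠ 0 := one_sub_real_mul_ne_zero hc₀ hc₁.le hz
  have hcz : ‖(c : ℂ) * z‖ < 1 := by
    rw [norm_mul, Complex.norm_real, Real.norm_of_nonneg hc₀]
    nlinarith [norm_nonneg z]
  have hden : 1 - (a : ℂ) * (γ : ℂ) - (a : ℂ) * (1 - (γ : ℂ)) * z
      = (1 - (a : ℂ) * (γ : ℂ)) * (1 - (c : ℂ) * z) := by
    rw [hc]
    push_cast
    field_simp
  rw [← hasSum_nat_add_iff' 1]
  set K : ℝ := -((1 - γ) * (1 - a ^ 2) / (1 - a * γ) ^ 2) with hK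
  have htail : (fun n => z ^ (n + 1) * (moebiusCoeff γ a (n + 1) : ℂ))
      = fun n => z * (K : ℂ) * ((c : ℂ) * z) ^ n := by
    funext n
    simp only [moebiusCoeff, ← hc, ← hK]
    push_cast
    ring
  have hhead : ∑ i ∈ Finset.range 1, z ^ i * (moebiusCoeff γ a i : ℂ)
      = ((a : ℂ) - γ) / (1 - a * γ) := by
    simp [moebiusCoeff]
  have hval : ((a : ℂ) - (γ : ℂ) - (1 - (γ : ℂ)) * z) /
        (1 - (a : ℂ) * (γ : ℂ) - (a : ℂ) * (1 - (γ : ℂ)) * z) - ((a : ℂ) - γ) / (1 - a * γ)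
      = z * (K : ℂ) * (1 - (c : ℂ) * z)⁻¹ := by
    rw [sub_eq_iff_eq_add, hden, div_eq_iff (mul_ne_zero hDc hne), add_mul]
    have h : z * (K : ℂ) * (1 - (c : ℂ) * z)⁻¹ * ((1 - (a : ℂ) * γ) * (1 - (c : ℂ) * z))
        = z * (K : ℂ) * (1 - (a : ℂ) * γ) := by
      linear_combination z * (K : ℂ) * (1 - (a : ℂ) * γ) * inv_mul_cancel₀ hne
    rw [h, hK, hc]
    push_cast
    field_simp
    ring
  rw [htail, hhead, hval]
  exact (hasSum_geometric_of_norm_lt_one hcz).mul_left _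

lemma abs_moebiusCoeff_succ {γ a : ℝ} (hγ₀ : 0 ≤ γ) (haγ : γ < a) (ha₁ : a < 1)
    (n : ℕ) : |moebiusCoeff γ a (n + 1)|
      = (1 - γ) * (1 - a ^ 2) / (1 - a * γ) ^ 2 * (a * (1 - γ) / (1 - a * γ)) ^ n := by
  have h : 0 ≤ (1 - γ) * (1 - a ^ 2) / (1 - a * γ) ^ 2 :=
    div_nonneg (mul_nonneg (by linarith) (by nlinarith)) (sq_nonneg _)
  rw [moebiusCoeff, neg_mul, abs_neg, abs_of_nonneg]
  exact mul_nonneg h (pow_nonneg (moebius_ratio_mem_Ico hγ₀ haγ ha₁).1 n)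

/-- If `p(1+γ)b₀ < 2 ∑ b_{n+1}`, the Bohr sum of the Möbius map exceeds `b₀` for some `a`. -/
lemma exists_moebiusCoeff_bohr_lt {γ p : ℝ} (hγ₀ : 0 ≤ γ) (hγ₁ : γ < 1) (hp : 0 ≤ p)
    {b : ℕ → ℝ} (hb : ∀ n, 0 ≤ b n) (hsum : Summable b)
    (hcond : p * (1 + γ) * b 0 < 2 * ∑' n, b (n + 1)) :
    ∃ a ∈ Set.Ioo γ 1,
      b 0 < moebiusCoeff γ a 0 ^ p * b 0 + ∑' n, |moebiusCoeff γ a (n + 1)| * b (n + 1) := by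
  have hsum' : Summable fun n => b (n + 1) := (summable_nat_add_iff 1).2 hsum
  obtain ⟨N, hN⟩ : ∃ N, p * (1 + γ) * b 0 < 2 * ∑ n ∈ Finset.range N, b (n + 1) :=
    ((hsum'.hasSum.tendsto_sum_nat.const_mul 2).eventually_const_lt hcond).exists
  have hδ : 0 < 1 - γ := sub_pos.2 hγ₁
  have hlim : ∀ᶠ a in 𝓝 (1 : ℝ), p * (1 + γ) * b 0 / (a - γ)
      < (1 - γ) * (1 + a) / (1 - a * γ) ^ 2 *
        ∑ n ∈ Finset.range N, (a * (1 - γ) / (1 - a * γ)) ^ n * b (n + 1) := by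
    have hD : 1 - 1 * γ ≠ 0 := by rw [one_mul]; exact hδ.ne'
    refine ContinuousAt.eventually_lt ?_ ?_ ?_
    · fun_prop (disch := exact hδ.ne')
    · fun_prop (disch := first | exact hD | exact pow_ne_zero 2 hD)
    · have h₁ : 1 * (1 - γ) / (1 - 1 * γ) = 1 := by
        rw [one_mul, one_mul, div_self hδ.ne']
      have h₂ : (1 - γ) * (1 + 1) / (1 - 1 * γ) ^ 2 = 2 / (1 - γ) := by
        rw [one_mul]
        field_simp
        ring
      simp only [h₁, h₂, one_pow, one_mul (b _)]
      rw [div_mul_eq_mul_div]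
      exact div_lt_div_of_pos_right hN hδ
  obtain ⟨a, hlt, haγ, ha₁⟩ :=
    ((hlim.filter_mono nhdsWithin_le_nhds).and (Ioo_mem_nhdsLT hγ₁)).exists
  refine ⟨a, ⟨haγ, ha₁⟩, ?_⟩
  have hD : 0 < 1 - a * γ := by nlinarith
  have hc := moebius_ratio_mem_Ico hγ₀ haγ ha₁
  simp only [abs_moebiusCoeff_succ hγ₀ haγ ha₁]
  set c : ℝ := a * (1 - γ) / (1 - a * γ)
  have hK : 0 ≤ (1 - γ) * (1 - a ^ 2) / (1 - a * γ) ^ 2 :=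
    div_nonneg (mul_nonneg hδ.le (by nlinarith)) (sq_nonneg _)
  have hpow : Summable fun n => c ^ n * b (n + 1) :=
    hsum'.of_nonneg_of_le (fun n => mul_nonneg (pow_nonneg hc.1 n) (hb _))
      (fun n => mul_le_of_le_one_left (hb _) (pow_le_one₀ hc.1 hc.2.le))
  have hpart : ∑ n ∈ Finset.range N, c ^ n * b (n + 1) ≤ ∑' n, c ^ n * b (n + 1) :=
    hpow.sum_le_tsum _ (fun n _ => mul_nonneg (pow_nonneg hc.1 n) (hb _))
  have hx : 0 < (a - γ) / (1 - a * γ) := div_pos (by linarith) hD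
  have hhead : (1 - moebiusCoeff γ a 0 ^ p) * b 0 ≤ (1 - a) * (p * (1 + γ) * b 0 / (a - γ)) := by
    refine (mul_le_mul_of_nonneg_right (one_sub_rpow_le hx hp) (hb 0)).trans_eq ?_
    have h₃ : a - γ ≠ 0 := (sub_pos.2 haγ).ne'
    have h₄ := hD.ne'
    field_simp
    ring
  have htail := mul_lt_mul_of_pos_left hlt (sub_pos.2 ha₁)
  have hfac : (1 - a) * ((1 - γ) * (1 + a) / (1 - a * γ) ^ 2 *
      ∑ n ∈ Finset.range N, c ^ n * b (n + 1))
      = (1 - γ) * (1 - a ^ 2) / (1 - a * γ) ^ 2 * ∑ n ∈ Finset.range N, c ^ n * b (n + 1) := by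
    ring
  have hfull := mul_le_mul_of_nonneg_left hpart hK
  simp only [mul_assoc ((1 - γ) * (1 - a ^ 2) / (1 - a * γ) ^ 2), tsum_mul_left]
  linarith

/-- Sharpness assertion of Theorem 3.2 in the case `m = 0`, `μ ≡ 0`: whenever
`2 ∑_{n≥1} φ_n(r) > p (1+γ) φ₀(r)`, the Bohr-type inequality fails for some
member of `H^∞(Ω_γ, B(H))`, which may be taken of the explicit Möbius form. -/
theorem bohr_generalized_weighted_OmegaGamma_sharp
    {H : Type*} [NormedAddCommGroup H] [InnerProductSpace ℂ H]
    [CompleteSpace H] [Nontrivial H]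
    (γ : ℝ) (hγ : γ ∈ Set.Ico (0 : ℝ) 1)
    (p : ℝ) (hp : p ∈ Set.Ioc (0 : ℝ) 2)
    (φ : ℕ → ℝ → ℝ)
    (hφcont : ∀ n, ContinuousOn (φ n) (Set.Ico 0 1))
    (hφnonneg : ∀ n, ∀ r ∈ Set.Ico (0 : ℝ) 1, 0 ≤ φ n r)
    (hφconv : ∃ g : ℝ → ℝ, TendstoLocallyUniformlyOn
      (fun N r => ∑ n ∈ Finset.range N, φ n r) g Filter.atTop (Set.Ico 0 1))
    (r : ℝ) (hr : r ∈ Set.Ioo (0 : ℝ) 1)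
    (hcond : p * (1 + γ) * φ 0 r < 2 * ∑' n : ℕ, φ (n + 1) r) :
    ∃ f : ℂ → H →L[ℂ] H,
      DifferentiableOn ℂ f (OmegaGamma γ) ∧
      (∀ z ∈ OmegaGamma γ, ‖f z‖ ≤ 1) ∧
      ∃ A : ℕ → H →L[ℂ] H,
        (∀ z ∈ Metric.ball (0 : ℂ) 1, f z = ∑' n : ℕ, z ^ n • A n) ∧
        (∃ a₀ : ℝ, a₀ ∈ Set.Ioo (0 : ℝ) 1 ∧ A 0 = (a₀ : ℂ) • (1 : H →L[ℂ] H)) ∧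
        φ 0 r < ‖A 0‖ ^ p * φ 0 r + ∑' n : ℕ, ‖A (n + 1)‖ * φ (n + 1) r ∧
        ∃ a : ℝ, a ∈ Set.Ioo γ 1 ∧
          ∀ z : ℂ, f z =
            (((a : ℂ) - (γ : ℂ) - (1 - (γ : ℂ)) * z) /
              (1 - (a : ℂ) * (γ : ℂ) - (a : ℂ) * (1 - (γ : ℂ)) * z)) •
              (1 : H →L[ℂ] H) := by
  obtain ⟨hγ₀, hγ₁⟩ := hγ
  obtain ⟨g, hg⟩ := hφconv
  have hr' : r ∈ Set.Ico (0 : ℝ) 1 := ⟨hr.1.le, hr.2⟩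
  have hsum : Summable fun n => φ n r :=
    ((hasSum_iff_tendsto_nat_of_nonneg (fun n => hφnonneg n r hr') _).2
      (hg.tendsto_at hr')).summable
  obtain ⟨a, ⟨haγ, ha₁⟩, hlt⟩ :=
    exists_moebiusCoeff_bohr_lt hγ₀ hγ₁ hp.1.le (fun n => hφnonneg n r hr') hsum hcond
  have ha₀ : 0 ≤ a := hγ₀.trans haγ.le
  have hD : 0 < 1 - a * γ := by nlinarith
  have hnum (z : ℂ) : (a : ℂ) - (γ : ℂ) - (1 - (γ : ℂ)) * z
      = a - (γ + (1 - (γ : ℂ)) * z) := by ring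
  have hden (z : ℂ) : 1 - (a : ℂ) * (γ : ℂ) - (a : ℂ) * (1 - (γ : ℂ)) * z
      = 1 - a * (γ + (1 - (γ : ℂ)) * z) := by ring
  have hmem : moebiusCoeff γ a 0 ∈ Set.Ioo (0 : ℝ) 1 := by
    refine ⟨div_pos (by linarith) hD, ?_⟩
    rw [moebiusCoeff, div_lt_one hD]
    nlinarith
  have hnorm (n : ℕ) : ‖(moebiusCoeff γ a n : ℂ) • (1 : H →L[ℂ] H)‖ = |moebiusCoeff γ a n| := by
    rw [norm_smul, norm_one, mul_one, Complex.norm_real, Real.norm_eq_abs]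
  refine ⟨fun z => (((a : ℂ) - (γ : ℂ) - (1 - (γ : ℂ)) * z) /
      (1 - (a : ℂ) * (γ : ℂ) - (a : ℂ) * (1 - (γ : ℂ)) * z)) • (1 : H →L[ℂ] H), ?_, ?_,
    fun n => (moebiusCoeff γ a n : ℂ) • (1 : H →L[ℂ] H), ?_,
    ⟨moebiusCoeff γ a 0, hmem, rfl⟩, ?_, a, ⟨haγ, ha₁⟩, fun _ => rfl⟩
  · refine DifferentiableOn.smul_const (DifferentiableOn.div (by fun_prop) (by fun_prop) ?_) _
    intro z hz
    rw [hden]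
    exact one_sub_real_mul_ne_zero ha₀ ha₁.le (norm_affine_lt_one_of_mem_OmegaGamma hγ₁ hz)
  · intro z hz
    rw [norm_smul, norm_one, mul_one, hnum, hden]
    exact norm_real_moebius_le_one ha₀ ha₁.le (norm_affine_lt_one_of_mem_OmegaGamma hγ₁ hz)
  · intro z hz
    have h := (hasSum_moebiusCoeff hγ₀ haγ ha₁ (mem_ball_zero_iff.1 hz)).smul_const
      (1 : H →L[ℂ] H)
    simp only [mul_smul] at h
    exact h.tsum_eq.symm
  · simp only [hnorm]
    rwa [abs_of_pos hmem.1]
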